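/- arXiv:1803.01905 — 2 statements merged into one kernel-verified Lean document; each statement's English description precedes it below -/
import Mathlib

section
/- For steepest descent with respect to an arbitrary norm ‖·‖ on ℝ^d, applied to the exponential loss over linearly separable data with fixed step size 0 < η < 1/L(w(0)), the ‖·‖-normalized margin converges to the ‖·‖-maximum margin at rate 1/log t: there exist a constant C > 0 and a time t₀ such that for all t > t₀, min_n ⟨w(t), x_n⟩ / ‖w(t)‖ ≥ γ − C / log t. -/
open scoped RealInnerProductSpace BigOperators
open Filter

/-- The exponential loss `L(w) = ∑ₙ exp(-⟨w, xₙ⟩)`. -/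
noncomputable def expLoss {d N : ℕ} (x : Fin N → EuclideanSpace ℝ (Fin d))
    (w : EuclideanSpace ℝ (Fin d)) : ℝ :=
  ∑ n, Real.exp (-⟪w, x n⟫)

/-- The gradient of the exponential loss, `∇L(w) = -∑ₙ exp(-⟨w, xₙ⟩) xₙ`. -/
noncomputable def expLossGrad {d N : ℕ} (x : Fin N → EuclideanSpace ℝ (Fin d))
    (w : EuclideanSpace ℝ (Fin d)) : EuclideanSpace ℝ (Fin d) :=
  -∑ n, Real.exp (-⟪w, x n⟫) • x n

/-- The dual norm `‖v‖_* = sup {⟨v, u⟩ : ‖u‖ ≤ 1}` of a (general) norm `nrm` on `ℝ^d`. -/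
noncomputable def dualNorm {d : ℕ} (nrm : EuclideanSpace ℝ (Fin d) → ℝ)
    (v : EuclideanSpace ℝ (Fin d)) : ℝ :=
  sSup ((fun u => ⟪v, u⟫) '' {u | nrm u ≤ 1})


/-- A norm on `ℝ^d` has a Euclidean-bounded unit ball. -/
lemma nrm_ball_bounded {d : ℕ} (nrm : EuclideanSpace ℝ (Fin d) → ℝ)
    (hnrm_nonneg : ∀ v, 0 ≤ nrm v)
    (hnrm_eq_zero : ∀ v, nrm v = 0 ↔ v = 0)
    (hnrm_smul : ∀ (c : ℝ) v, nrm (c • v) = |c| * nrm v)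
    (hnrm_add : ∀ u v, nrm (u + v) ≤ nrm u + nrm v) :
    ∃ K : ℝ, 0 ≤ K ∧ ∀ u, ‖u‖ ≤ K * nrm u := by
  let p : Seminorm ℝ (EuclideanSpace ℝ (Fin d)) :=
    Seminorm.of nrm hnrm_add (by intro a v; rw [hnrm_smul, Real.norm_eq_abs])
  have hconv : ConvexOn ℝ Set.univ nrm := p.convexOn
  have hcont : Continuous nrm := by
    rw [← continuousOn_univ]
    exact hconv.continuousOn isOpen_univ
  by_cases hne : (Metric.sphere (0 : EuclideanSpace ℝ (Fin d)) 1).Nonempty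
  · obtain ⟨v, hv, hmin⟩ := (isCompact_sphere (0 : EuclideanSpace ℝ (Fin d)) 1).exists_isMinOn hne
      hcont.continuousOn
    have hv1 : ‖v‖ = 1 := by simpa using hv
    have hvpos : 0 < nrm v := by
      refine lt_of_le_of_ne (hnrm_nonneg v) fun h => ?_
      have := (hnrm_eq_zero v).1 h.symm
      rw [this] at hv1
      simp at hv1
    refine ⟨(nrm v)⁻¹, by positivity, fun u => ?_⟩
    by_cases hu : u = 0
    · subst hu
      have := hnrm_nonneg 0
      simp only [norm_zero]
      positivity
    have hun : 0 < ‖u‖ := norm_pos_iff.2 hu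
    have h1 : nrm v ≤ nrm (‖u‖⁻¹ • u) := by
      apply hmin
      simp [norm_smul, hun.ne']
    rw [hnrm_smul, abs_of_pos (by positivity)] at h1
    rw [inv_mul_eq_div, le_div_iff₀ hvpos]
    rw [inv_mul_eq_div, le_div_iff₀ hun] at h1
    linarith
  · refine ⟨0, le_rfl, fun u => ?_⟩
    by_cases hu : u = 0
    · simp [hu]
    exfalso
    apply hne
    have hun : 0 < ‖u‖ := norm_pos_iff.2 hu
    exact ⟨‖u‖⁻¹ • u, by simp [norm_smul, hun.ne']⟩

lemma inner_le_dualNorm {d : ℕ} (nrm : EuclideanSpace ℝ (Fin d) → ℝ)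
    (hnrm_nonneg : ∀ v, 0 ≤ nrm v)
    (hnrm_eq_zero : ∀ v, nrm v = 0 ↔ v = 0)
    (hnrm_smul : ∀ (c : ℝ) v, nrm (c • v) = |c| * nrm v)
    (hnrm_add : ∀ u v, nrm (u + v) ≤ nrm u + nrm v)
    (v u : EuclideanSpace ℝ (Fin d)) (hu : nrm u ≤ 1) : ⟪v, u⟫ ≤ dualNorm nrm v := by
  obtain ⟨K, hK, hb⟩ := nrm_ball_bounded nrm hnrm_nonneg hnrm_eq_zero hnrm_smul hnrm_add
  refine le_csSup ⟨‖v‖ * K, ?_⟩ ⟨u, hu, rfl⟩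
  rintro _ ⟨y, hy, rfl⟩
  have hy' : nrm y ≤ 1 := hy
  have h1 : ‖y‖ ≤ K := (hb y).trans (by nlinarith)
  exact (real_inner_le_norm v y).trans (by gcongr)

/-- Scalar core: from the descent recursion to the margin and rate bounds. -/
lemma scalar_core (L g : ℕ → ℝ) (η γ : ℝ) (hη : 0 < η) (hγ : 0 < γ)
    (hL : ∀ t, 0 < L t) (hη' : η * L 0 < 1) (hg1 : ∀ t, γ * L t ≤ g t)
    (hstep : ∀ t, L t ≤ L 0 → L (t + 1) ≤ L t - η * g t ^ 2 * (1 - η * L t)) :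
    (∀ t, L t ≤ L 0) ∧
    (∀ t, η * γ ^ 2 * (1 - η * L 0) * t ≤ 1 / L t) ∧
    (∀ t, Real.log (L t) ≤ Real.log (L 0) - γ * ∑ s ∈ Finset.range t, η * g s
      + η / (1 - η * L 0) * (L 0 - L t)) := by
  have hδ : 0 < 1 - η * L 0 := by linarith
  have hdec : ∀ t, L t ≤ L 0 → L (t + 1) ≤ L t - η * g t ^ 2 * (1 - η * L 0) := by
    intro t ht
    refine (hstep t ht).trans ?_
    gcongr
  have hmono : ∀ t, L t ≤ L 0 := by
    intro t
    induction t with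
    | zero => exact le_rfl
    | succ t ih =>
      have := hdec t ih
      have : 0 ≤ η * g t ^ 2 * (1 - η * L 0) := by positivity
      linarith
  refine ⟨hmono, ?_, ?_⟩
  · intro t
    induction t with
    | zero => simpa using (hL 0).le
    | succ t ih =>
      have h1 := hdec t (hmono t)
      have hLt := hL t
      have hLs := hL (t + 1)
      set c := η * γ ^ 2 * (1 - η * L 0) with hc
      have hc0 : 0 < c := by positivity
      have h2 : c * L t ^ 2 ≤ η * g t ^ 2 * (1 - η * L 0) := by
        have : (γ * L t) ^ 2 ≤ g t ^ 2 := by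
          have := hg1 t
          gcongr
        calc c * L t ^ 2 = η * (γ * L t) ^ 2 * (1 - η * L 0) := by rw [hc]; ring
          _ ≤ _ := by gcongr
      have h3 : L (t + 1) ≤ L t - c * L t ^ 2 := by linarith
      have h4 : 1 / L t + c ≤ 1 / L (t + 1) := by
        rw [le_div_iff₀ hLs]
        have h5 : (1 / L t + c) * L (t + 1) ≤ (1 / L t + c) * (L t - c * L t ^ 2) := by
          gcongr
        have h6 : (1 / L t + c) * (L t - c * L t ^ 2) = 1 - (c * L t) ^ 2 := by
          field_simp
          ring
        nlinarith [sq_nonneg (c * L t)]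
      push_cast
      linarith
  · intro t
    induction t with
    | zero => simp
    | succ t ih =>
      have h1 := hdec t (hmono t)
      have h0 := hstep t (hmono t)
      have hLt := hL t
      have hLs := hL (t + 1)
      have hgt : 0 < g t := lt_of_lt_of_le (by positivity) (hg1 t)
      rw [Finset.sum_range_succ]
      have h2 : Real.log (L (t + 1)) - Real.log (L t) ≤ L (t + 1) / L t - 1 := by
        rw [← Real.log_div hLs.ne' hLt.ne']
        exact Real.log_le_sub_one_of_pos (by positivity)
      have h3 : L (t + 1) / L t - 1 ≤ - (γ * (η * g t)) + η ^ 2 * g t ^ 2 := by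
        rw [sub_le_iff_le_add, div_le_iff₀ hLt]
        have : η * g t * (γ * L t) ≤ η * g t * g t := by
          have := hg1 t
          gcongr
        nlinarith
      have h4 : η ^ 2 * g t ^ 2 ≤ η / (1 - η * L 0) * (L t - L (t + 1)) := by
        rw [div_mul_eq_mul_div, le_div_iff₀ hδ]
        have := mul_le_mul_of_nonneg_left h1 hη.le
        nlinarith
      have h5 : η / (1 - η * L 0) * (L 0 - L (t+1)) = η / (1 - η * L 0) * (L 0 - L t)
          + η / (1 - η * L 0) * (L t - L (t+1)) := by ring
      rw [h5]
      linarith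

/-- Steepest descent w.r.t. an arbitrary norm on the exponential loss over separable data,
with fixed step size `0 < η < 1/L(w(0))`, drives the `‖·‖`-normalized margin to the
`‖·‖`-max margin `γ` at rate `1/log t`. -/
theorem steepest_descent_expLoss_margin_rate_log
    {d N : ℕ} (nrm : EuclideanSpace ℝ (Fin d) → ℝ)
    (hnrm_nonneg : ∀ v, 0 ≤ nrm v)
    (hnrm_eq_zero : ∀ v, nrm v = 0 ↔ v = 0)
    (hnrm_smul : ∀ (c : ℝ) v, nrm (c • v) = |c| * nrm v)
    (hnrm_add : ∀ u v, nrm (u + v) ≤ nrm u + nrm v)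
    (x : Fin N → EuclideanSpace ℝ (Fin d))
    (hx : ∀ n, dualNorm nrm (x n) ≤ 1)
    (hsep : ∃ wstar : EuclideanSpace ℝ (Fin d), ∀ n, 0 < ⟪wstar, x n⟫)
    (hNe : (Finset.univ : Finset (Fin N)).Nonempty)
    (γ : ℝ)
    (hγ : IsGreatest {m : ℝ | ∃ u : EuclideanSpace ℝ (Fin d), nrm u ≤ 1 ∧
        m = Finset.univ.inf' hNe (fun n => ⟪u, x n⟫)} γ)
    (η : ℝ) (w Δ : ℕ → EuclideanSpace ℝ (Fin d))
    (hη : 0 < η) (hη' : η < 1 / expLoss x (w 0))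
    (hΔ_norm : ∀ t : ℕ, nrm (Δ t) = 1)
    (hΔ_steep : ∀ t : ℕ, ⟪Δ t, expLossGrad x (w t)⟫ = dualNorm nrm (expLossGrad x (w t)))
    (hSD : ∀ t : ℕ,
      w (t + 1) = w t - (η * dualNorm nrm (expLossGrad x (w t))) • Δ t) :
    ∃ C > 0, ∃ t₀ : ℕ, ∀ t : ℕ, t > t₀ →
      γ - C / Real.log t ≤
        Finset.univ.inf' hNe (fun n => ⟪w t, x n⟫ / nrm (w t)) := by
  have hdual := inner_le_dualNorm nrm hnrm_nonneg hnrm_eq_zero hnrm_smul hnrm_add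
  set L : ℕ → ℝ := fun t => expLoss x (w t) with hLdef
  set g : ℕ → ℝ := fun t => dualNorm nrm (expLossGrad x (w t)) with hgdef
  have hLpos : ∀ t, 0 < L t := fun t => Finset.sum_pos (fun n _ => Real.exp_pos _) hNe
  have hηL : η * L 0 < 1 := (lt_div_iff₀ (hLpos 0)).1 hη'
  have hneg : ∀ u, nrm (-u) = nrm u := by
    intro u
    have := hnrm_smul (-1) u
    simpa using this
  -- bound of inner products with the data by the norm
  have hxle : ∀ n u, ⟪u, x n⟫ ≤ nrm u := by
    intro n u
    by_cases hu : u = 0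
    · subst hu
      simpa using hnrm_nonneg 0
    have hup : 0 < nrm u := lt_of_le_of_ne (hnrm_nonneg u)
      (fun h => hu ((hnrm_eq_zero u).1 h.symm))
    have h1 := (hdual (x n) ((nrm u)⁻¹ • u) (by
      rw [hnrm_smul, abs_of_pos (by positivity), inv_mul_cancel₀ hup.ne'])).trans (hx n)
    rw [inner_smul_right, inv_mul_eq_div, div_le_one hup, real_inner_comm] at h1
    exact h1
  have hxabs : ∀ n u, |⟪u, x n⟫| ≤ nrm u := by
    intro n u
    refine abs_le.2 ⟨?_, hxle n u⟩
    have := hxle n (-u)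
    rw [inner_neg_left, hneg] at this
    linarith
  -- positivity of the margin
  have hγpos : 0 < γ := by
    obtain ⟨v, hv⟩ := hsep
    obtain ⟨n0, _⟩ := id hNe
    have hvp : 0 < nrm v := lt_of_lt_of_le (hv n0) (hxle n0 v)
    have h1 : Finset.univ.inf' hNe (fun n => ⟪(nrm v)⁻¹ • v, x n⟫) ≤ γ :=
      hγ.2 ⟨(nrm v)⁻¹ • v, by
        rw [hnrm_smul, abs_of_pos (by positivity), inv_mul_cancel₀ hvp.ne'], rfl⟩
    refine lt_of_lt_of_le ?_ h1
    rw [Finset.lt_inf'_iff]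
    intro n _
    rw [real_inner_smul_left]
    have := hv n
    positivity
  have hinnerG : ∀ t u, ⟪u, expLossGrad x (w t)⟫ =
      -∑ n, Real.exp (-⟪w t, x n⟫) * ⟪u, x n⟫ := by
    intro t u
    simp only [expLossGrad, inner_neg_right, inner_sum, inner_smul_right]
  have hg1 : ∀ t, γ * L t ≤ g t := by
    intro t
    obtain ⟨u, hu, hγu⟩ := hγ.1
    have h1 := hdual (expLossGrad x (w t)) (-u) (by rw [hneg]; exact hu)
    rw [real_inner_comm, hinnerG] at h1
    refine le_trans ?_ h1
    simp only [inner_neg_left, mul_neg, Finset.sum_neg_distrib, neg_neg]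
    simp only [hLdef, expLoss, Finset.mul_sum]
    refine Finset.sum_le_sum fun n _ => ?_
    have h2 : γ ≤ ⟪u, x n⟫ := by
      rw [hγu]
      exact Finset.inf'_le _ (Finset.mem_univ n)
    rw [mul_comm]
    gcongr
  have hgpos : ∀ t, 0 < g t := fun t => lt_of_lt_of_le (mul_pos hγpos (hLpos t)) (hg1 t)
  have hgL : ∀ t, g t ≤ L t := by
    intro t
    have h1 : g t = _ := (hΔ_steep t).symm.trans (hinnerG t (Δ t))
    rw [h1, ← Finset.sum_neg_distrib]
    refine Finset.sum_le_sum fun n _ => ?_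
    have h2 := (abs_le.1 (hxabs n (Δ t))).1
    rw [hΔ_norm] at h2
    nlinarith [Real.exp_pos (-⟪w t, x n⟫)]
  have hstep : ∀ t, L t ≤ L 0 → L (t + 1) ≤ L t - η * g t ^ 2 * (1 - η * L t) := by
    intro t ht
    have hs0 : 0 < η * g t := mul_pos hη (hgpos t)
    have hs1 : η * g t ≤ 1 := by
      have := mul_le_mul_of_nonneg_left ((hgL t).trans ht) hη.le
      linarith
    have h1 : g t = -∑ n, Real.exp (-⟪w t, x n⟫) * ⟪Δ t, x n⟫ :=
      (hΔ_steep t).symm.trans (hinnerG t (Δ t))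
    have h2 : ∀ n, Real.exp (-⟪w (t + 1), x n⟫) ≤ Real.exp (-⟪w t, x n⟫)
        + (η * g t) * (Real.exp (-⟪w t, x n⟫) * ⟪Δ t, x n⟫)
        + (η * g t) ^ 2 * Real.exp (-⟪w t, x n⟫) := by
      intro n
      have ha := hxabs n (Δ t)
      rw [hΔ_norm] at ha
      set a := ⟪Δ t, x n⟫ with hadef
      have e1 : -⟪w (t + 1), x n⟫ = -⟪w t, x n⟫ + (η * g t) * a := by
        rw [hSD t, inner_sub_left, real_inner_smul_left]
        ring
      have hsa : |(η * g t) * a| ≤ 1 := by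
        rw [abs_mul, abs_of_pos hs0]
        exact mul_le_one₀ hs1 (abs_nonneg a) ha
      have h3 := (abs_le.1 (Real.abs_exp_sub_one_sub_id_le hsa)).2
      have ha2 : a ^ 2 ≤ 1 := by
        rw [← sq_abs]
        exact pow_le_one₀ (abs_nonneg a) ha
      have h4 : Real.exp ((η * g t) * a) ≤ 1 + (η * g t) * a + (η * g t) ^ 2 := by
        have : ((η * g t) * a) ^ 2 ≤ (η * g t) ^ 2 := by
          rw [mul_pow]
          exact mul_le_of_le_one_right (sq_nonneg _) ha2
        linarith
      rw [e1, Real.exp_add]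
      have := mul_le_mul_of_nonneg_left h4 (Real.exp_pos (-⟪w t, x n⟫)).le
      linarith
    have h5 : L (t + 1) ≤ L t + (η * g t) * (-g t) + (η * g t) ^ 2 * L t := by
      have := Finset.sum_le_sum fun n (_ : n ∈ (Finset.univ : Finset (Fin N))) => h2 n
      rw [Finset.sum_add_distrib, Finset.sum_add_distrib, ← Finset.mul_sum,
        ← Finset.mul_sum] at this
      have h6 : -g t = ∑ n, Real.exp (-⟪w t, x n⟫) * ⟪Δ t, x n⟫ := by rw [h1, neg_neg]
      rw [h6]
      exact this
    linarith
  obtain ⟨hmono, hrate, hlog⟩ := scalar_core L g η γ hη hγpos hLpos hηL hg1 hstep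
  have hδ : 0 < 1 - η * L 0 := by linarith
  -- growth of the norm
  have hnw : ∀ t, nrm (w t) ≤ nrm (w 0) + ∑ s ∈ Finset.range t, η * g s := by
    intro t
    induction t with
    | zero => simp
    | succ t ih =>
      rw [Finset.sum_range_succ, hSD t, sub_eq_add_neg]
      refine (hnrm_add _ _).trans ?_
      rw [hneg, hnrm_smul, hΔ_norm, abs_of_pos (mul_pos hη (hgpos t))]
      linarith
  have hmarg : ∀ t n, -Real.log (L t) ≤ ⟪w t, x n⟫ := by
    intro t n
    have h1 : Real.exp (-⟪w t, x n⟫) ≤ L t :=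
      Finset.single_le_sum (f := fun n => Real.exp (-⟪w t, x n⟫))
        (fun i _ => (Real.exp_pos _).le) (Finset.mem_univ n)
    have := (Real.le_log_iff_exp_le (hLpos t)).2 h1
    linarith
  set c := η * γ ^ 2 * (1 - η * L 0) with hc
  have hc0 : 0 < c := by positivity
  set B := |Real.log (L 0)| + γ * nrm (w 0) + η / (1 - η * L 0) * L 0 with hB
  have hB0 : 0 ≤ B := by
    have := hnrm_nonneg (w 0)
    have := hLpos 0
    positivity
  obtain ⟨T, hT⟩ := exists_nat_gt ((c ^ 2)⁻¹)
  refine ⟨2 * B + 1, by positivity, max T 2, fun t ht => ?_⟩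
  have htT : T < t := lt_of_le_of_lt (le_max_left _ _) ht
  have ht2 : 2 < t := lt_of_le_of_lt (le_max_right _ _) ht
  have ht1 : (1 : ℝ) < t := by exact_mod_cast (by omega : 1 < t)
  have htpos : (0 : ℝ) < t := by linarith
  have hlogt : 0 < Real.log t := Real.log_pos ht1
  have hct : 1 ≤ c ^ 2 * t := by
    have h1 : (c ^ 2)⁻¹ ≤ t := hT.le.trans (by exact_mod_cast htT.le)
    rw [inv_le_iff_one_le_mul₀ (by positivity)] at h1
    linarith
  have h1 : 0 ≤ 2 * Real.log c + Real.log t := by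
    have := Real.log_nonneg hct
    rw [Real.log_mul (by positivity) (by positivity), Real.log_pow] at this
    exact_mod_cast this
  have h2 : Real.log c + Real.log t ≤ -Real.log (L t) := by
    rw [← Real.log_mul hc0.ne' htpos.ne', ← Real.log_inv, ← one_div]
    exact Real.log_le_log (by positivity) (hrate t)
  obtain ⟨n0, _⟩ := id hNe
  have h3 : Real.log t / 2 ≤ nrm (w t) := by
    have := (hmarg t n0).trans (hxle n0 (w t))
    linarith
  have hnpos : 0 < nrm (w t) := by linarith
  rw [Finset.le_inf'_iff]
  intro n _
  have h4 : γ * nrm (w t) - B ≤ ⟪w t, x n⟫ := by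
    refine le_trans ?_ (hmarg t n)
    have e1 := hlog t
    have e2 := mul_le_mul_of_nonneg_left (hnw t) hγpos.le
    have e3 : η / (1 - η * L 0) * (L 0 - L t) ≤ η / (1 - η * L 0) * L 0 := by
      have := (hLpos t).le
      gcongr
      linarith
    have e4 := le_abs_self (Real.log (L 0))
    rw [mul_add] at e2
    linarith
  have h5 : γ - B / nrm (w t) ≤ ⟪w t, x n⟫ / nrm (w t) := by
    rw [le_div_iff₀ hnpos, sub_mul, div_mul_cancel₀ _ hnpos.ne']
    exact h4
  have h6 : B / nrm (w t) ≤ (2 * B + 1) / Real.log t := by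
    rw [div_le_div_iff₀ hnpos hlogt]
    nlinarith
  linarith
end

section
/- Unnormalized margin lower bound for gradient descent on the exponential loss: if the fixed step size satisfies 0 < η < 1/L(w(0)), then for every t ≥ 0, min_n ⟨w(t+1), x_n⟩ ≥ η Σ_{i=0}^{t} ‖∇L(w(i))‖² / L(w(i)) − (η²/2) Σ_{i=0}^{t} ‖∇L(w(i))‖² − log L(w(0)). -/
open scoped RealInnerProductSpace BigOperators
open Filter

/-- Hoeffding's lemma for a finite weighted sum. -/
lemma finite_hoeffding {N : ℕ} (q s : Fin N → ℝ) (a : ℝ) (hq : ∀ n, 0 ≤ q n)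
    (hq1 : ∑ n, q n = 1) (hs : ∀ n, s n ∈ Set.Icc (-a) a) :
    ∑ n, q n * Real.exp (-s n) ≤ Real.exp (-(∑ n, q n * s n) + a ^ 2 / 2) := by
  have h1 : ∑ n, ENNReal.ofReal (q n) = 1 := by
    rw [← ENNReal.ofReal_sum_of_nonneg (fun n _ => hq n), hq1, ENNReal.ofReal_one]
  let p : PMF (Fin N) := PMF.ofFintype (fun n => ENNReal.ofReal (q n)) h1
  have hint : ∀ f : Fin N → ℝ, ∫ n, f n ∂p.toMeasure = ∑ n, q n * f n := by
    intro f
    rw [PMF.integral_eq_sum]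
    refine Finset.sum_congr rfl fun n _ => ?_
    simp [p, hq n]
  have H := ProbabilityTheory.hasSubgaussianMGF_of_mem_Icc (μ := p.toMeasure) (X := s)
    (a := -a) (b := a) (by fun_prop) (Filter.Eventually.of_forall hs)
  have H2 := H.mgf_le (-1)
  rw [ProbabilityTheory.mgf, hint, hint] at H2
  set m := ∑ n, q n * s n with hm
  have e : ∀ n, q n * Real.exp (-s n) = Real.exp (-m) * (q n * Real.exp (-1 * (s n - m))) := by
    intro n
    rw [mul_left_comm, ← Real.exp_add]
    congr 2
    ring
  rw [Finset.sum_congr rfl fun n _ => e n, ← Finset.mul_sum, Real.exp_add]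
  refine mul_le_mul_of_nonneg_left (H2.trans (le_of_eq ?_)) (Real.exp_pos _).le
  congr 1
  push_cast
  rw [Real.norm_eq_abs, div_pow, sq_abs]
  ring

/-- One step of gradient descent. -/
lemma expLoss_step {d N : ℕ} (x : Fin N → EuclideanSpace ℝ (Fin d))
    (hx : ∀ n, ‖x n‖ ≤ 1) (η : ℝ) (hη : 0 < η) (u : EuclideanSpace ℝ (Fin d))
    (hL : 0 < expLoss x u) :
    expLoss x (u - η • expLossGrad x u) ≤ expLoss x u *
      Real.exp (-(η * (‖expLossGrad x u‖ ^ 2 / expLoss x u))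
        + η ^ 2 / 2 * ‖expLossGrad x u‖ ^ 2) := by
  set g := expLossGrad x u with hg
  set L := expLoss x u with hLdef
  have hs : ∀ n, -(η * ⟪g, x n⟫) ∈ Set.Icc (-(η * ‖g‖)) (η * ‖g‖) := by
    intro n
    have h : |⟪g, x n⟫| ≤ ‖g‖ := (abs_real_inner_le_norm _ _).trans
      (mul_le_of_le_one_right (norm_nonneg _) (hx n))
    rw [abs_le] at h
    constructor <;> nlinarith [h.1, h.2]
  have hgg : ∑ n, Real.exp (-⟪u, x n⟫) * ⟪g, x n⟫ = -‖g‖ ^ 2 := by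
    rw [← real_inner_self_eq_norm_sq]
    nth_rewrite 3 [hg]
    rw [expLossGrad, inner_neg_right, neg_neg, inner_sum]
    simp only [real_inner_smul_right]
  have H := finite_hoeffding (fun n => Real.exp (-⟪u, x n⟫) / L) (fun n => -(η * ⟪g, x n⟫))
    (η * ‖g‖) (fun n => by positivity)
    (by rw [← Finset.sum_div]; exact div_self hL.ne') hs
  have e1 : ∑ n, Real.exp (-⟪u, x n⟫) / L * -(η * ⟪g, x n⟫) = η * (‖g‖ ^ 2 / L) := by
    have : ∀ n, Real.exp (-⟪u, x n⟫) / L * -(η * ⟪g, x n⟫)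
        = (-η / L) * (Real.exp (-⟪u, x n⟫) * ⟪g, x n⟫) := fun n => by ring
    rw [Finset.sum_congr rfl fun n _ => this n, ← Finset.mul_sum, hgg]
    ring
  have e2 : expLoss x (u - η • g)
      = L * ∑ n, Real.exp (-⟪u, x n⟫) / L * Real.exp (- -(η * ⟪g, x n⟫)) := by
    rw [expLoss, Finset.mul_sum]
    refine Finset.sum_congr rfl fun n _ => ?_
    rw [inner_sub_left, real_inner_smul_left, neg_sub, sub_eq_add_neg, Real.exp_add, neg_neg]
    field_simp
  rw [e1] at H
  rw [e2]
  refine mul_le_mul_of_nonneg_left (H.trans (le_of_eq ?_)) hL.le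
  congr 1
  ring

/-- Unnormalized margin lower bound for gradient descent on the exponential loss:
`minₙ ⟨w(t+1), xₙ⟩ ≥ η ∑_{i≤t} ‖∇L(w(i))‖²/L(w(i)) − (η²/2) ∑_{i≤t} ‖∇L(w(i))‖² − log L(w(0))`. -/
theorem gd_expLoss_unnormalized_margin_bound
    {d N : ℕ} (x : Fin N → EuclideanSpace ℝ (Fin d))
    (hx : ∀ n, ‖x n‖ ≤ 1)
    (hsep : ∃ wstar : EuclideanSpace ℝ (Fin d), ∀ n, 0 < ⟪wstar, x n⟫)
    (η : ℝ) (w : ℕ → EuclideanSpace ℝ (Fin d))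
    (hη : 0 < η) (hη' : η < 1 / expLoss x (w 0))
    (hGD : ∀ t : ℕ, w (t + 1) = w t - η • expLossGrad x (w t)) :
    ∀ t : ℕ, ∀ n : Fin N,
      η * ∑ i ∈ Finset.range (t + 1), ‖expLossGrad x (w i)‖ ^ 2 / expLoss x (w i)
        - η ^ 2 / 2 * ∑ i ∈ Finset.range (t + 1), ‖expLossGrad x (w i)‖ ^ 2
        - Real.log (expLoss x (w 0))
      ≤ ⟪w (t + 1), x n⟫ := by
  intro t n
  have hpos : ∀ u, 0 < expLoss x u := fun u =>
    Finset.sum_pos (fun _ _ => Real.exp_pos _) ⟨n, Finset.mem_univ n⟩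
  have key : ∀ t : ℕ, Real.log (expLoss x (w t)) ≤ Real.log (expLoss x (w 0))
      - η * ∑ i ∈ Finset.range t, ‖expLossGrad x (w i)‖ ^ 2 / expLoss x (w i)
      + η ^ 2 / 2 * ∑ i ∈ Finset.range t, ‖expLossGrad x (w i)‖ ^ 2 := by
    intro t
    induction t with
    | zero => simp
    | succ k ih =>
      have h := Real.log_le_log (hpos _) (expLoss_step x hx η hη (w k) (hpos _))
      rw [Real.log_mul (hpos _).ne' (Real.exp_pos _).ne', Real.log_exp, ← hGD] at h
      rw [Finset.sum_range_succ, Finset.sum_range_succ, mul_add, mul_add]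
      linarith
  have h1 : Real.exp (-⟪w (t + 1), x n⟫) ≤ expLoss x (w (t + 1)) :=
    Finset.single_le_sum (f := fun n => Real.exp (-⟪w (t + 1), x n⟫))
      (fun _ _ => (Real.exp_pos _).le) (Finset.mem_univ n)
  have h2 := Real.log_le_log (Real.exp_pos _) h1
  rw [Real.log_exp] at h2
  linarith [key (t + 1)]
end
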